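/- If v is a run in a word u whose shortest period is at least 2, then the ceiling of the exponent of v is at most |H(v)|/2 + 3, where H(v) is the set of handles of v. -/

import Mathlib

open scoped Classical

namespace RunsExp

variable {α : Type*}

/-- `p` is a period of the word `w`. -/
def IsPeriod (w : List α) (p : ℕ) : Prop :=
  0 < p ∧ ∀ i : ℕ, i + p < w.length → w[i]? = w[i + p]?

/-- The shortest period of the word `w`. -/
noncomputable def minPeriod (w : List α) : ℕ := sInf {p | IsPeriod w p}

/-- The factor `u[i..j]` of `u` (0-based indices, inclusive on both ends). -/
def factor (u : List α) (i j : ℕ) : List α := (u.drop i).take (j - i + 1)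

/-- `[i..j]` is a run in `u` (0-based indices): the shortest period `p` of `u[i..j]`
satisfies `2p ≤ j-i+1` and the interval can be extended neither to the left nor to
the right without violating this property. -/
def IsRun (u : List α) (i j : ℕ) : Prop :=
  i ≤ j ∧ j < u.length ∧
  2 * minPeriod (factor u i j) ≤ j - i + 1 ∧
  (i = 0 ∨ u[i - 1]? ≠ u[i + minPeriod (factor u i j) - 1]?) ∧
  (j = u.length - 1 ∨ u[j - minPeriod (factor u i j) + 1]? ≠ u[j + 1]?)

/-- The exponent of the run `[i..j]` of `u`. -/
noncomputable def exponent (u : List α) (i j : ℕ) : ℚ :=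
  ((j : ℚ) - (i : ℚ) + 1) / (minPeriod (factor u i j) : ℚ)

/-- The set of all runs of `u`, as a finset of pairs of indices. -/
noncomputable def runs (u : List α) : Finset (ℕ × ℕ) :=
  (Finset.range u.length ×ˢ Finset.range u.length).filter fun q => IsRun u q.1 q.2

/-- The sum of exponents of all runs in `u`. -/
noncomputable def sigma (u : List α) : ℚ :=
  ∑ q ∈ runs u, exponent u q.1 q.2

/-- The lexicographically minimal word cyclically equivalent to `w`. -/
noncomputable def minRot [LinearOrder α] (w : List α) : List α :=
  ((List.range w.length).map w.rotate).foldr min w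

/-- The lexicographically maximal word cyclically equivalent to `w`. -/
noncomputable def maxRot [LinearOrder α] (w : List α) : List α :=
  ((List.range w.length).map w.rotate).foldr max w

/-- The word `x` occurs in `u` at (0-based) starting position `s`, entirely within
the interval `[i..j]`. -/
def OccursAt (u : List α) (i j : ℕ) (x : List α) (s : ℕ) : Prop :=
  i ≤ s ∧ s + x.length ≤ j + 1 ∧ factor u s (s + x.length - 1) = x

/-- `s` and `s'` are starting positions of consecutive occurrences of `x`
inside the interval `[i..j]` of `u`. -/
def ConsecutiveOcc (u : List α) (i j : ℕ) (x : List α) (s s' : ℕ) : Prop :=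
  OccursAt u i j x s ∧ OccursAt u i j x s' ∧ s < s' ∧
    ∀ t, s < t → t < s' → ¬ OccursAt u i j x t

/-- The set of handles of the run `[i..j]` of `u`: inter-position `k` lies between
the letters at positions `k` and `k+1`.  If the minimal and maximal rotations of the
period-prefix `w` coincide, all inter-positions inside the run are handles; otherwise
the handles are the inter-positions between consecutive occurrences of the minimal
rotation and between consecutive occurrences of the maximal rotation. -/
noncomputable def handles [LinearOrder α] (u : List α) (i j : ℕ) : Set ℕ :=
  let p := minPeriod (factor u i j)
  let w := factor u i (i + p - 1)
  if minRot w = maxRot w then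
    {k | i ≤ k ∧ k < j}
  else
    {k | ∃ s s', (ConsecutiveOcc u i j (minRot w) s s' ∨
                  ConsecutiveOcc u i j (maxRot w) s s') ∧ k = s' - 1}

/-- `[i..j]` is a cubic run in `u`. -/
def IsCubicRun (u : List α) (i j : ℕ) : Prop :=
  IsRun u i j ∧ 3 * minPeriod (factor u i j) ≤ j - i + 1

/-- The set of all cubic runs of `u`. -/
noncomputable def cubicRuns (u : List α) : Finset (ℕ × ℕ) :=
  (Finset.range u.length ×ˢ Finset.range u.length).filter fun q => IsCubicRun u q.1 q.2

/-- The sum of exponents of all cubic runs in `u`. -/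
noncomputable def sigmaCubic (u : List α) : ℚ :=
  ∑ q ∈ cubicRuns u, exponent u q.1 q.2



theorem foldr_choice_mem {β : Type*} (f : β → β → β) (hf : ∀ a b, f a b = a ∨ f a b = b)
    (l : List β) (w : β) : l.foldr f w = w ∨ l.foldr f w ∈ l := by
  induction l with
  | nil => simp
  | cons a l ih =>
    simp only [List.foldr_cons, List.mem_cons]
    rcases hf a (l.foldr f w) with h | h <;> rw [h]
    · simp
    · tauto

theorem minRot_eq [LinearOrder α] (w : List α) (hw : 0 < w.length) :
    ∃ r < w.length, minRot w = w.rotate r := by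
  rcases foldr_choice_mem min (fun a b => min_choice a b)
    ((List.range w.length).map w.rotate) w with h | h
  · exact ⟨0, hw, by rw [List.rotate_zero]; exact h⟩
  · obtain ⟨r, hr, h2⟩ := List.mem_map.1 h
    exact ⟨r, List.mem_range.1 hr, h2.symm⟩

theorem maxRot_eq [LinearOrder α] (w : List α) (hw : 0 < w.length) :
    ∃ r < w.length, maxRot w = w.rotate r := by
  rcases foldr_choice_mem max (fun a b => max_choice a b)
    ((List.range w.length).map w.rotate) w with h | h
  · exact ⟨0, hw, by rw [List.rotate_zero]; exact h⟩
  · obtain ⟨r, hr, h2⟩ := List.mem_map.1 h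
    exact ⟨r, List.mem_range.1 hr, h2.symm⟩

theorem factor_get (u : List α) (i j a : ℕ) (ha : a ≤ j - i) :
    (factor u i j)[a]? = u[i + a]? := by
  unfold factor
  rw [List.getElem?_take, if_pos (by omega), List.getElem?_drop]

theorem factor_length (u : List α) (i j : ℕ) (hij : i ≤ j) (hj : j < u.length) :
    (factor u i j).length = j - i + 1 := by
  unfold factor
  simp; omega

theorem period_mod (u : List α) (i j p : ℕ) (hij : i ≤ j) (hj : j < u.length)
    (hP : IsPeriod (factor u i j) p) (n : ℕ) :
    i + n ≤ j → u[i + n]? = u[i + n % p]? := by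
  induction n using Nat.strong_induction_on with
  | _ n ih =>
    intro hn
    by_cases h : n < p
    · rw [Nat.mod_eq_of_lt h]
    · have h0 := hP.1
      have h1 := hP.2 (n - p) (by rw [factor_length u i j hij hj]; omega)
      rw [factor_get _ _ _ _ (by omega), factor_get _ _ _ _ (by omega)] at h1
      rw [show n - p + p = n by omega] at h1
      rw [← h1, ih (n - p) (by omega) (by omega), ← Nat.mod_eq_sub_mod (by omega)]

theorem occurs_rotate (u : List α) (i j p r k : ℕ) (hij : i ≤ j) (hj : j < u.length)
    (hP : IsPeriod (factor u i j) p) (hpj : i + p - 1 ≤ j)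
    (hk : i + (r + k * p) + p ≤ j + 1) :
    OccursAt u i j ((factor u i (i + p - 1)).rotate r) (i + (r + k * p)) := by
  have h0 := hP.1
  have hwl : (factor u i (i + p - 1)).length = p := by
    rw [factor_length _ _ _ (by omega) (by omega)]; omega
  refine ⟨by omega, by rw [List.length_rotate, hwl]; omega, ?_⟩
  rw [List.length_rotate, hwl]
  apply List.ext_getElem?
  intro a
  by_cases ha : a < p
  · rw [factor_get _ _ _ _ (by omega), List.getElem?_rotate (by omega), hwl,
      factor_get _ _ _ _ (by have := Nat.mod_lt (a + r) h0; omega), add_assoc,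
      period_mod u i j p hij hj hP _ (by omega)]
    rw [show r + k * p + a = a + r + k * p by ring, Nat.add_mul_mod_self_right]
  · rw [List.getElem?_eq_none, List.getElem?_eq_none]
    · rw [List.length_rotate, hwl]; omega
    · rw [factor_length _ _ _ (by omega) (by omega)]; omega

theorem exists_consecutive (u : List α) (i j : ℕ) (x : List α) (s s' : ℕ)
    (h : OccursAt u i j x s) (h' : OccursAt u i j x s') (hs : s < s') :
    ∃ t, ConsecutiveOcc u i j x t s' := by
  let P : ℕ → Prop := fun t => OccursAt u i j x t ∧ t < s'
  have hg : P (Nat.findGreatest P s') := Nat.findGreatest_spec (P := P) hs.le ⟨h, hs⟩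
  refine ⟨Nat.findGreatest P s', hg.1, h', hg.2, fun t h1 h2 h3 => ?_⟩
  exact Nat.findGreatest_is_greatest h1 h2.le ⟨h3, h2⟩

/-- If `v = [i..j]` is a run in `u` with shortest period at least `2`, then the
ceiling of its exponent is at most `|H(v)|/2 + 3`. -/
theorem ceil_exponent_le_handles [LinearOrder α] (u : List α) (i j : ℕ)
    (hrun : IsRun u i j) (hp : 2 ≤ minPeriod (factor u i j)) :
    ((⌈exponent u i j⌉ : ℚ)) ≤ ((handles u i j).ncard : ℚ) / 2 + 3 := by
  obtain ⟨hij, hj, h2p, -, -⟩ := hrun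
  have hP : IsPeriod (factor u i j) (minPeriod (factor u i j)) := by
    refine Nat.sInf_mem (s := {p | IsPeriod (factor u i j) p}) ?_
    by_contra hne
    rw [Set.not_nonempty_iff_eq_empty] at hne
    have : minPeriod (factor u i j) = 0 := by unfold minPeriod; rw [hne]; exact Nat.sInf_empty
    omega
  have key : ∀ N : ℕ, j - i + 1 ≤ N * minPeriod (factor u i j) →
      (2 * N ≤ (handles u i j).ncard + 6) →
      ((⌈exponent u i j⌉ : ℚ)) ≤ ((handles u i j).ncard : ℚ) / 2 + 3 := by
    intro N hN hH
    have h1 : ⌈exponent u i j⌉ ≤ (N : ℤ) := by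
      rw [Int.ceil_le]
      unfold exponent
      rw [div_le_iff₀ (by exact_mod_cast (by omega : 0 < minPeriod (factor u i j)))]
      have h3 : ((j - i + 1 : ℕ) : ℚ) ≤ ((N * minPeriod (factor u i j) : ℕ) : ℚ) := by
        exact_mod_cast hN
      push_cast [Nat.cast_sub hij] at h3
      exact_mod_cast h3
    have h2 : (⌈exponent u i j⌉ : ℚ) ≤ (N : ℚ) := by exact_mod_cast h1
    have h3 : (2 * N : ℚ) ≤ (handles u i j).ncard + 6 := by exact_mod_cast hH
    linarith
  generalize hpd : minPeriod (factor u i j) = p at *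
  have hwl : (factor u i (i + p - 1)).length = p := by
    rw [factor_length _ _ _ (by omega) (by omega)]; omega
  by_cases hmm : minRot (factor u i (i + p - 1)) = maxRot (factor u i (i + p - 1))
  · have hH : handles u i j = Set.Ico i j := by
      unfold handles
      simp only [hpd]
      rw [if_pos hmm]
      rfl
    have hc : (handles u i j).ncard = j - i := by
      rw [hH, ← Finset.coe_Ico, Set.ncard_coe_finset, Nat.card_Ico]
    refine key ((j - i + 2) / 2) ?_ (by omega)
    calc j - i + 1 ≤ (j - i + 2) / 2 * 2 := by omega
      _ ≤ _ := Nat.mul_le_mul_left _ hp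
  · have hH : handles u i j = {k | ∃ s s',
        (ConsecutiveOcc u i j (minRot (factor u i (i + p - 1))) s s' ∨
          ConsecutiveOcc u i j (maxRot (factor u i (i + p - 1))) s s') ∧ k = s' - 1} := by
      unfold handles
      simp only [hpd]
      rw [if_neg hmm]
    obtain ⟨r, hr, hmin⟩ := minRot_eq (factor u i (i + p - 1)) (by omega)
    obtain ⟨r', hr', hmax⟩ := maxRot_eq (factor u i (i + p - 1)) (by omega)
    rw [hwl] at hr hr'
    rw [hmin, hmax] at hmm hH
    obtain ⟨m, hm⟩ : ∃ m, m = (j - i + 1) / p := ⟨_, rfl⟩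
    have hm2 : 2 ≤ m := by rw [hm, Nat.le_div_iff_mul_le (by omega)]; exact h2p
    have hm1 : m * p ≤ j - i + 1 := by rw [hm]; exact Nat.div_mul_le_self _ _
    have hm3 : j - i + 1 ≤ (m + 1) * p := by
      have := Nat.lt_div_mul_add (a := j - i + 1) (b := p) (by omega)
      rw [← hm] at this
      rw [add_mul]; omega
    have occ : ∀ q < p, ∀ k < m - 1,
        OccursAt u i j ((factor u i (i + p - 1)).rotate q) (i + (q + k * p)) := by
      intro q hq k hk
      refine occurs_rotate u i j p q k hij hj hP (by omega) ?_
      have : (k + 2) * p ≤ m * p := Nat.mul_le_mul_right _ (by omega)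
      rw [add_mul] at this
      omega
    have cons : ∀ q < p, ∀ k < m - 2, ∃ t,
        ConsecutiveOcc u i j ((factor u i (i + p - 1)).rotate q) t (i + (q + (k + 1) * p)) := by
      intro q hq k hk
      refine exists_consecutive u i j _ (i + (q + k * p)) _ (occ q hq k (by omega))
        (occ q hq (k + 1) (by omega)) ?_
      rw [add_mul]; omega
    let f : ℕ → ℕ → ℕ := fun q k => i + (q + (k + 1) * p) - 1
    have finj : ∀ q, Function.Injective (f q) := by
      intro q a b hab
      simp only [f] at hab
      have h1 : (a + 1) * p = (b + 1) * p := by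
        rw [add_mul, add_mul] at *; omega
      have := Nat.eq_of_mul_eq_mul_right (by omega) h1
      omega
    let A := (Finset.range (m - 2)).image (f r)
    let B := (Finset.range (m - 2)).image (f r')
    have hAB : Disjoint A B := by
      rw [Finset.disjoint_left]
      intro x hxA hxB
      obtain ⟨a, ha, hxa⟩ := Finset.mem_image.1 hxA
      obtain ⟨b, hb, hxb⟩ := Finset.mem_image.1 hxB
      rw [Finset.mem_range] at ha hb
      have h1 := (occ r hr (a + 1) (by omega)).2.2
      have h2 := (occ r' hr' (b + 1) (by omega)).2.2
      rw [List.length_rotate, hwl] at h1 h2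
      have h3 : i + (r + (a + 1) * p) = i + (r' + (b + 1) * p) := by
        simp only [f] at hxa hxb
        rw [add_mul] at *
        rw [add_mul] at *
        omega
      rw [h3, h2] at h1
      exact hmm h1.symm
    have hsub : ((A ∪ B : Finset ℕ) : Set ℕ) ⊆ handles u i j := by
      intro x hx
      rw [hH]
      rcases Finset.mem_union.1 (Finset.mem_coe.1 hx) with hx | hx
      · obtain ⟨a, ha, hxa⟩ := Finset.mem_image.1 hx
        obtain ⟨t, ht⟩ := cons r hr a (Finset.mem_range.1 ha)
        exact ⟨t, _, Or.inl ht, hxa.symm⟩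
      · obtain ⟨a, ha, hxa⟩ := Finset.mem_image.1 hx
        obtain ⟨t, ht⟩ := cons r' hr' a (Finset.mem_range.1 ha)
        exact ⟨t, _, Or.inr ht, hxa.symm⟩
    have hfin : (handles u i j).Finite := by
      apply (Set.finite_Iic (j + 1)).subset
      intro x hx
      rw [hH] at hx
      obtain ⟨s, s', h | h, rfl⟩ := hx
      · have := h.2.1.2.1
        rw [Set.mem_Iic]; omega
      · have := h.2.1.2.1
        rw [Set.mem_Iic]; omega
    have hcard := Set.ncard_le_ncard hsub hfin
    rw [Set.ncard_coe_finset, Finset.card_union_of_disjoint hAB,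
      Finset.card_image_of_injective _ (finj r), Finset.card_image_of_injective _ (finj r'),
      Finset.card_range] at hcard
    exact key (m + 1) hm3 (by omega)
end RunsExp
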